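/- arXiv:0910.0810 — 6 statements merged into one kernel-verified Lean document; each statement's English description precedes it below -/
import Mathlib

section
/- If a, φ : I → ℝ are twice differentiable on an interval I, a(t) > 0 on I, and a, φ satisfy the FRW field equations a'' = 2aV(φ) − 2a(φ')² and φ'' = −3(a'/a)φ' − V'(φ) on I, then the function E(t) = a'(t)² − 2a(t)²V(φ(t)) − a(t)²φ'(t)² is constant on I. -/
/-- If `a, φ` are twice differentiable on an interval `I`, `a > 0` on `I`, and satisfy the
FRW field equations `a'' = 2aV(φ) - 2a(φ')²` and `φ'' = -3(a'/a)φ' - V'(φ)` on `I`,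
then `E = (a')² - 2a²V(φ) - a²(φ')²` is constant on `I`. -/
theorem FRW_energy_constant
    (V : ℝ → ℝ) (hV : ContDiff ℝ 1 V)
    (I : Set ℝ) (hI : I.OrdConnected)
    (a φ a' φ' a'' φ'' : ℝ → ℝ)
    (ha' : ∀ t ∈ I, HasDerivAt a (a' t) t)
    (ha'' : ∀ t ∈ I, HasDerivAt a' (a'' t) t)
    (hφ' : ∀ t ∈ I, HasDerivAt φ (φ' t) t)
    (hφ'' : ∀ t ∈ I, HasDerivAt φ' (φ'' t) t)
    (hpos : ∀ t ∈ I, 0 < a t)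
    (heq1 : ∀ t ∈ I, a'' t = 2 * a t * V (φ t) - 2 * a t * (φ' t) ^ 2)
    (heq2 : ∀ t ∈ I, φ'' t = -3 * (a' t / a t) * φ' t - deriv V (φ t)) :
    ∀ t ∈ I, ∀ s ∈ I,
      (a' t) ^ 2 - 2 * (a t) ^ 2 * V (φ t) - (a t) ^ 2 * (φ' t) ^ 2
        = (a' s) ^ 2 - 2 * (a s) ^ 2 * V (φ s) - (a s) ^ 2 * (φ' s) ^ 2 := by
  have hE : ∀ t ∈ I, HasDerivWithinAt
      (fun t => (a' t) ^ 2 - 2 * (a t) ^ 2 * V (φ t) - (a t) ^ 2 * (φ' t) ^ 2) 0 I t := by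
    intro t ht
    have hVφ : HasDerivAt (fun t => V (φ t)) (deriv V (φ t) * φ' t) t :=
      ((hV.differentiable one_ne_zero) (φ t)).hasDerivAt.comp t (hφ' t ht)
    have h :=
      ((((ha'' t ht).fun_pow 2).fun_sub ((((ha' t ht).fun_pow 2).const_mul 2).fun_mul hVφ)).fun_sub
        (((ha' t ht).fun_pow 2).fun_mul ((hφ'' t ht).fun_pow 2)))
    refine (h.congr_deriv ?_).hasDerivWithinAt
    have hne := (hpos t ht).ne'
    rw [heq1 t ht, heq2 t ht]
    field_simp
    ring
  intro t ht s hs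
  have h := hI.convex.norm_image_sub_le_of_norm_hasDerivWithin_le (C := 0) hE (by simp) hs ht
  rw [zero_mul] at h
  exact sub_eq_zero.mp (norm_le_zero_iff.mp h)
end

section
/- Let V(φ) = c·e^{−2φ} for a constant c. If a, φ : ℝ → ℝ are twice differentiable with a(t) > 0 and satisfy the FRW field equations a'' = 2aV(φ) − 2a(φ')² and φ'' = −3(a'/a)φ' − V'(φ), then for every ε ∈ ℝ the transformed pair ã(t) = a(e^{−ε}t), φ̃(t) = φ(e^{−ε}t) + ε also satisfies the FRW field equations (with the same potential V). -/
/-- Flow of `X = t∂_t + ∂_φ` for the exponential potential `V(φ) = c·e^{-2φ}`: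
if `(a, φ)` solves the FRW field equations `a'' = 2aV(φ) - 2a(φ')²`,
`φ'' = -3(a'/a)φ' - V'(φ)` with `a > 0`, then for every `ε ∈ ℝ` the pair
`ã(t) = a(e^{-ε}t)`, `φ̃(t) = φ(e^{-ε}t) + ε` also solves them (same potential). -/
theorem FRW_scaling_flow_exponential_potential
    (c : ℝ) (V : ℝ → ℝ) (hVdef : ∀ x, V x = c * Real.exp (-2 * x))
    (a φ : ℝ → ℝ)
    (ha : ∀ t, DifferentiableAt ℝ a t)
    (ha' : ∀ t, DifferentiableAt ℝ (deriv a) t)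
    (hφ : ∀ t, DifferentiableAt ℝ φ t)
    (hφ' : ∀ t, DifferentiableAt ℝ (deriv φ) t)
    (hpos : ∀ t, 0 < a t)
    (heq1 : ∀ t, deriv (deriv a) t = 2 * a t * V (φ t) - 2 * a t * (deriv φ t) ^ 2)
    (heq2 : ∀ t, deriv (deriv φ) t
      = -3 * (deriv a t / a t) * deriv φ t - deriv V (φ t)) :
    ∀ ε : ℝ,
      (∀ t, 0 < a (Real.exp (-ε) * t)) ∧
      (∀ t, deriv (deriv (fun u => a (Real.exp (-ε) * u))) t
        = 2 * a (Real.exp (-ε) * t) * V (φ (Real.exp (-ε) * t) + ε)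
          - 2 * a (Real.exp (-ε) * t)
            * (deriv (fun u => φ (Real.exp (-ε) * u) + ε) t) ^ 2) ∧
      (∀ t, deriv (deriv (fun u => φ (Real.exp (-ε) * u) + ε)) t
        = -3 * (deriv (fun u => a (Real.exp (-ε) * u)) t / a (Real.exp (-ε) * t))
            * deriv (fun u => φ (Real.exp (-ε) * u) + ε) t
          - deriv V (φ (Real.exp (-ε) * t) + ε)) := by
  intro ε
  have hVshift : ∀ x, V (x + ε) = Real.exp (-ε) ^ 2 * V x := by
    intro x
    rw [hVdef, hVdef, ← Real.exp_nat_mul, mul_left_comm, ← Real.exp_add]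
    congr 2
    push_cast
    ring
  have hV'shift : ∀ x, deriv V (x + ε) = Real.exp (-ε) ^ 2 * deriv V x := by
    intro x
    rw [← deriv_comp_add_const V ε x, funext hVshift, deriv_const_mul_field]
  have hscale : ∀ f : ℝ → ℝ, deriv (fun u => f (Real.exp (-ε) * u))
      = fun u => Real.exp (-ε) * deriv f (Real.exp (-ε) * u) :=
    fun f => funext fun u => deriv_comp_mul_left (Real.exp (-ε)) f u
  have hscale₂ : ∀ (f : ℝ → ℝ) (t : ℝ), deriv (deriv (fun u => f (Real.exp (-ε) * u))) t
      = Real.exp (-ε) ^ 2 * deriv (deriv f) (Real.exp (-ε) * t) := by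
    intro f t
    rw [hscale f, deriv_const_mul_field, hscale (deriv f)]
    ring
  have hadd : deriv (fun u => φ (Real.exp (-ε) * u) + ε)
      = deriv (fun u => φ (Real.exp (-ε) * u)) :=
    funext fun u => deriv_add_const ε
  refine ⟨fun t => hpos _, fun t => ?_, fun t => ?_⟩
  · rw [hadd, hscale₂, hscale, heq1, hVshift]
    ring
  · rw [hadd, hscale₂, hscale, hscale, heq2, hV'shift]
    ring
end

section
/- If a, φ : I → ℝ are twice differentiable on an interval I, a(t) > 0 on I, and satisfy the proper-time Einstein equations φ'' = −3(a'/a)φ' − V'(φ) and −2a a'' − (a')² − k − 3a²(φ')² + 6a²V(φ) = 0 on I, then the function P(t) = a(t)·(a'(t)² + k − 2a(t)²V(φ(t)) − a(t)²φ'(t)²) is constant on I. -/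
/-- If `a, φ` are twice differentiable on an interval `I`, `a > 0` on `I`, and satisfy the
proper-time Einstein equations `φ'' = -3(a'/a)φ' - V'(φ)` and
`-2a a'' - (a')² - k - 3a²(φ')² + 6a²V(φ) = 0` on `I`, then the Noether quantity
`P = a·((a')² + k - 2a²V(φ) - a²(φ')²)` is constant on `I`. -/
theorem proper_time_Noether_quantity_constant
    (V : ℝ → ℝ) (hV : ContDiff ℝ 1 V) (k : ℝ)
    (I : Set ℝ) (hI : I.OrdConnected)
    (a φ a' φ' a'' φ'' : ℝ → ℝ)
    (ha' : ∀ t ∈ I, HasDerivAt a (a' t) t)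
    (ha'' : ∀ t ∈ I, HasDerivAt a' (a'' t) t)
    (hφ' : ∀ t ∈ I, HasDerivAt φ (φ' t) t)
    (hφ'' : ∀ t ∈ I, HasDerivAt φ' (φ'' t) t)
    (hpos : ∀ t ∈ I, 0 < a t)
    (heqφ : ∀ t ∈ I, φ'' t = -3 * (a' t / a t) * φ' t - deriv V (φ t))
    (heqa : ∀ t ∈ I, -2 * a t * a'' t - (a' t) ^ 2 - k - 3 * (a t) ^ 2 * (φ' t) ^ 2
      + 6 * (a t) ^ 2 * V (φ t) = 0) :
    ∀ t ∈ I, ∀ s ∈ I,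
      a t * ((a' t) ^ 2 + k - 2 * (a t) ^ 2 * V (φ t) - (a t) ^ 2 * (φ' t) ^ 2)
        = a s * ((a' s) ^ 2 + k - 2 * (a s) ^ 2 * V (φ s) - (a s) ^ 2 * (φ' s) ^ 2) := by
  have hP : ∀ t ∈ I, HasDerivWithinAt
      (fun t => a t * ((a' t) ^ 2 + k - 2 * (a t) ^ 2 * V (φ t) - (a t) ^ 2 * (φ' t) ^ 2))
      0 I t := by
    intro t ht
    have hVφ : HasDerivAt (fun t => V (φ t)) (deriv V (φ t) * φ' t) t :=
      ((hV.differentiable one_ne_zero) (φ t)).hasDerivAt.comp t (hφ' t ht)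
    have ha2 := (ha' t ht).fun_pow 2
    have h := (ha' t ht).fun_mul (((((ha'' t ht).fun_pow 2).add_const k).fun_sub
      ((ha2.const_mul 2).fun_mul hVφ)).fun_sub (ha2.fun_mul ((hφ'' t ht).fun_pow 2)))
    refine (h.congr_deriv ?_).hasDerivWithinAt
    have hφ : a t * φ'' t = -3 * a' t * φ' t - a t * deriv V (φ t) := by
      have := (hpos t ht).ne'
      rw [heqφ t ht]
      field_simp
    push_cast
    linear_combination -(a' t) * heqa t ht - 2 * (a t) ^ 2 * φ' t * hφ
  intro t ht s hs
  have h := hI.convex.norm_image_sub_le_of_norm_hasDerivWithin_le (C := 0) hP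
    (fun _ _ => norm_zero.le) hs ht
  rw [zero_mul] at h
  exact sub_eq_zero.mp (norm_le_zero_iff.mp h)
end

section
/- For all twice differentiable a, φ : I → ℝ on an interval I (no equations of motion assumed), the following Noether identity in characteristic form holds at every t ∈ I: a'·(∂L/∂a − d/dt(∂L/∂a')) + φ'·(∂L/∂φ − d/dt(∂L/∂φ')) = d/dt[ (1/2)·a·((a')² + k − 2a²V(φ) − a²(φ')²) ], where L = −(1/2)a(a')² + (1/2)ka + (1/2)a³(φ')² − a³V(φ) and all partial derivatives are evaluated along (a(t), a'(t), φ(t), φ'(t)). -/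
/-- The FRW Lagrangian in proper time, `L(a, a', φ, φ')`, as a function of the four
variables `(A, P, F, Q)` standing for `(a, a', φ, φ')`. -/
noncomputable def FRWLagrangian (V : ℝ → ℝ) (k : ℝ) (A P F Q : ℝ) : ℝ :=
  -(1/2) * A * P ^ 2 + (1/2) * k * A + (1/2) * A ^ 3 * Q ^ 2 - A ^ 3 * V F

/-- The Euler–Lagrange expression in `a`, `∂L/∂a − d/dt(∂L/∂a')`, along a curve. -/
noncomputable def ELa (V : ℝ → ℝ) (k : ℝ) (a a' φ φ' : ℝ → ℝ) (t : ℝ) : ℝ :=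
  deriv (fun x => FRWLagrangian V k x (a' t) (φ t) (φ' t)) (a t)
    - deriv (fun s => deriv (fun p => FRWLagrangian V k (a s) p (φ s) (φ' s)) (a' s)) t

/-- The Euler–Lagrange expression in `φ`, `∂L/∂φ − d/dt(∂L/∂φ')`, along a curve. -/
noncomputable def ELφ (V : ℝ → ℝ) (k : ℝ) (a a' φ φ' : ℝ → ℝ) (t : ℝ) : ℝ :=
  deriv (fun x => FRWLagrangian V k (a t) (a' t) x (φ' t)) (φ t)
    - deriv (fun s => deriv (fun q => FRWLagrangian V k (a s) (a' s) (φ s) q) (φ' s)) t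

theorem FRWLagrangian_hasDerivAt_scale (V : ℝ → ℝ) (k A P F Q : ℝ) :
    HasDerivAt (fun x => FRWLagrangian V k x P F Q)
      (-(1/2) * P ^ 2 + (1/2) * k + (3/2) * A ^ 2 * Q ^ 2 - 3 * A ^ 2 * V F) A := by
  have hx := hasDerivAt_id' A
  refine (((((hx.const_mul (-(1/2))).mul_const (P ^ 2)).add (hx.const_mul ((1/2) * k))).add
    (((hx.pow 3).const_mul (1/2)).mul_const (Q ^ 2))).sub
      ((hx.pow 3).mul_const (V F))).congr_deriv ?_
  push_cast
  ring

theorem FRWLagrangian_hasDerivAt_scale_velocity (V : ℝ → ℝ) (k A P F Q : ℝ) :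
    HasDerivAt (fun p => FRWLagrangian V k A p F Q) (-(A * P)) P := by
  refine ((((((hasDerivAt_id' P).pow 2).const_mul (-(1/2) * A)).add_const
    ((1/2) * k * A)).add_const ((1/2) * A ^ 3 * Q ^ 2)).sub_const (A ^ 3 * V F)).congr_deriv ?_
  norm_num
  ring

theorem FRWLagrangian_hasDerivAt_field {V : ℝ → ℝ} {V' F : ℝ} (hV : HasDerivAt V V' F)
    (k A P Q : ℝ) :
    HasDerivAt (fun x => FRWLagrangian V k A P x Q) (-(A ^ 3 * V')) F :=
  (hV.const_mul (A ^ 3)).const_sub _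

theorem FRWLagrangian_hasDerivAt_field_velocity (V : ℝ → ℝ) (k A P F Q : ℝ) :
    HasDerivAt (fun q => FRWLagrangian V k A P F q) (A ^ 3 * Q) Q := by
  refine (((((hasDerivAt_id' Q).pow 2).const_mul ((1/2) * A ^ 3)).const_add
    (-(1/2) * A * P ^ 2 + (1/2) * k * A)).sub_const (A ^ 3 * V F)).congr_deriv ?_
  norm_num
  ring

/-- Noether identity in characteristic form for the time-translation symmetry of the FRW
Lagrangian `L = -(1/2)a(a')² + (1/2)ka + (1/2)a³(φ')² - a³V(φ)`: with no equations of
motion assumed, `a'·EL_a + φ'·EL_φ = d/dt[(1/2)a((a')² + k - 2a²V(φ) - a²(φ')²)]`. -/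
theorem FRW_Noether_identity
    (V : ℝ → ℝ) (hV : ContDiff ℝ 1 V) (k : ℝ)
    (I : Set ℝ) (hI : I.OrdConnected)
    (a φ a' φ' a'' φ'' : ℝ → ℝ)
    (ha' : ∀ t ∈ I, HasDerivAt a (a' t) t)
    (ha'' : ∀ t ∈ I, HasDerivAt a' (a'' t) t)
    (hφ' : ∀ t ∈ I, HasDerivAt φ (φ' t) t)
    (hφ'' : ∀ t ∈ I, HasDerivAt φ' (φ'' t) t) :
    ∀ t ∈ I,
      a' t * ELa V k a a' φ φ' t + φ' t * ELφ V k a a' φ φ' t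
        = deriv (fun s => (1/2) * a s
            * ((a' s) ^ 2 + k - 2 * (a s) ^ 2 * V (φ s) - (a s) ^ 2 * (φ' s) ^ 2)) t := by
  intro t ht
  have ha := ha' t ht
  have hp := ha'' t ht
  have hφ := hφ' t ht
  have hq := hφ'' t ht
  have hVF : HasDerivAt V (deriv V (φ t)) (φ t) :=
    (hV.differentiable one_ne_zero (φ t)).hasDerivAt
  have hVφ : HasDerivAt (fun s => V (φ s)) (deriv V (φ t) * φ' t) t := hVF.comp t hφ
  have hEnergy := (ha.const_mul (1/2)).mul
    ((((hp.pow 2).add_const k).sub (((ha.pow 2).const_mul 2).mul hVφ)).sub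
      ((ha.pow 2).mul (hq.pow 2)))
  have hMomentum_a : deriv (fun s => -(a s * a' s)) t = -(a' t * a' t + a t * a'' t) :=
    (ha.mul hp).neg.deriv
  have hMomentum_φ := ((ha.pow 3).mul hq).deriv
  unfold ELa ELφ
  simp only [(FRWLagrangian_hasDerivAt_scale V k _ _ _ _).deriv,
    (FRWLagrangian_hasDerivAt_scale_velocity V k _ _ _ _).deriv,
    (FRWLagrangian_hasDerivAt_field hVF k _ _ _).deriv,
    (FRWLagrangian_hasDerivAt_field_velocity V k _ _ _ _).deriv]
  refine Eq.trans ?_ hEnergy.deriv.symm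
  rw [hMomentum_a, show deriv (fun s => a s ^ 3 * φ' s) t = _ from hMomentum_φ]
  simp only [Pi.pow_apply, Pi.mul_apply, Pi.sub_apply]
  norm_num
  ring
end

section
/- Let a, φ : I → ℝ be twice differentiable on an interval I with a(t) > 0, satisfying the proper-time Einstein equations with k = 0: φ'' = −3(a'/a)φ' − V'(φ) and −2a a'' − (a')² − 3a²(φ')² + 6a²V(φ) = 0. Suppose y, w : J → ℝ are differentiable on an open interval J containing φ(I) with y(φ(t)) = φ'(t) and w(φ(t)) = a'(t)/a(t) for all t ∈ I. Then for every interior t ∈ I, writing x = φ(t): y(x)·y'(x) + 3w(x)y(x) + V'(x) = 0 and 2y(x)·w'(x) + 3w(x)² + 3y(x)² − 6V(x) = 0. -/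
/-- Reduction of the proper-time Einstein equations with `k = 0` by the invariants
`x = φ`, `y = φ'`, `w = a'/a`: if `(a, φ)` solves `φ'' = -3(a'/a)φ' - V'(φ)` and
`-2a a'' - (a')² - 3a²(φ')² + 6a²V(φ) = 0` on an interval `I` with `a > 0`, and `y, w`
are differentiable on an open interval `J ⊇ φ(I)` with `y(φ(t)) = φ'(t)` and
`w(φ(t)) = a'(t)/a(t)` on `I`, then at every interior point `t` of `I`, with `x = φ(t)`:
`y(x)y'(x) + 3w(x)y(x) + V'(x) = 0` and `2y(x)w'(x) + 3w(x)² + 3y(x)² - 6V(x) = 0`. -/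
theorem proper_time_reduction_to_first_order
    (V : ℝ → ℝ) (hV : ContDiff ℝ 1 V)
    (I : Set ℝ) (hI : I.OrdConnected)
    (a φ a' φ' a'' φ'' : ℝ → ℝ)
    (ha' : ∀ t ∈ I, HasDerivAt a (a' t) t)
    (ha'' : ∀ t ∈ I, HasDerivAt a' (a'' t) t)
    (hφ' : ∀ t ∈ I, HasDerivAt φ (φ' t) t)
    (hφ'' : ∀ t ∈ I, HasDerivAt φ' (φ'' t) t)
    (hpos : ∀ t ∈ I, 0 < a t)
    (heqφ : ∀ t ∈ I, φ'' t = -3 * (a' t / a t) * φ' t - deriv V (φ t))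
    (heqa : ∀ t ∈ I, -2 * a t * a'' t - (a' t) ^ 2 - 3 * (a t) ^ 2 * (φ' t) ^ 2
      + 6 * (a t) ^ 2 * V (φ t) = 0)
    (J : Set ℝ) (hJopen : IsOpen J) (hJ : J.OrdConnected) (hJI : φ '' I ⊆ J)
    (y w y' w' : ℝ → ℝ)
    (hy : ∀ x ∈ J, HasDerivAt y (y' x) x)
    (hw : ∀ x ∈ J, HasDerivAt w (w' x) x)
    (hyφ : ∀ t ∈ I, y (φ t) = φ' t)
    (hwφ : ∀ t ∈ I, w (φ t) = a' t / a t) :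
    ∀ t ∈ interior I,
      y (φ t) * y' (φ t) + 3 * w (φ t) * y (φ t) + deriv V (φ t) = 0 ∧
      2 * y (φ t) * w' (φ t) + 3 * (w (φ t)) ^ 2 + 3 * (y (φ t)) ^ 2 - 6 * V (φ t) = 0 := by
  intro t ht
  have htI : t ∈ I := interior_subset ht
  have hnhds : I ∈ nhds t := mem_interior_iff_mem_nhds.mp ht
  have hJt : φ t ∈ J := hJI ⟨t, htI, rfl⟩
  have ha : a t ≠ 0 := (hpos t htI).ne'
  have hyt : y' (φ t) * φ' t = φ'' t := by
    refine ((hy _ hJt).comp t (hφ' t htI)).unique ((hφ'' t htI).congr_of_eventuallyEq ?_)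
    filter_upwards [hnhds] with s hs using hyφ s hs
  have hwt : w' (φ t) * φ' t = (a'' t * a t - a' t * a' t) / a t ^ 2 := by
    refine ((hw _ hJt).comp t (hφ' t htI)).unique
      (((ha'' t htI).div (ha' t htI) ha).congr_of_eventuallyEq ?_)
    filter_upwards [hnhds] with s hs using hwφ s hs
  rw [hyφ t htI, hwφ t htI]
  constructor
  · linear_combination hyt + heqφ t htI
  · have hE := heqa t htI
    have hclear : 2 * ((a'' t * a t - a' t * a' t) / a t ^ 2) + 3 * (a' t / a t) ^ 2
        + 3 * φ' t ^ 2 - 6 * V (φ t) = 0 := by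
      field_simp
      linear_combination -hE
    linear_combination 2 * hwt + hclear
end

section
/- For all twice differentiable a, φ, N : I → ℝ on an interval I with N(t) > 0 (no equations of motion assumed), the following Noether identity holds at every t ∈ I: a'·(∂L/∂a − d/dt(∂L/∂a')) + φ'·(∂L/∂φ − d/dt(∂L/∂φ')) + N'·(∂L/∂N) = d/dt[ (a/(2N))·((a')² + N²k − 2N²a²V(φ) − a²(φ')²) ], where L = −(a(a')²)/(2N) + (1/2)kNa + (a³(φ')²)/(2N) − Na³V(φ) and all partial derivatives are evaluated along (a(t), a'(t), φ(t), φ'(t), N(t)); note L does not depend on N', so the Euler–Lagrange expression in N is just ∂L/∂N. -/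
/-- The full Einstein–Hilbert FRW Lagrangian with lapse, `L(a, a', φ, φ', N)`, as a
function of the five variables `(A, P, F, Q, n)` standing for `(a, a', φ, φ', N)`. -/
noncomputable def FullLagrangian (V : ℝ → ℝ) (k : ℝ) (A P F Q n : ℝ) : ℝ :=
  -(A * P ^ 2) / (2 * n) + (1/2) * k * n * A + (A ^ 3 * Q ^ 2) / (2 * n) - n * A ^ 3 * V F

theorem FullLagrangian_hasDerivAt_scale (V : ℝ → ℝ) (k A P F Q n : ℝ) (hn : n ≠ 0) :
    HasDerivAt (fun x => FullLagrangian V k x P F Q n)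
      (-(P ^ 2) / (2 * n) + (1/2) * k * n + 3 * A ^ 2 * Q ^ 2 / (2 * n) - 3 * n * A ^ 2 * V F)
      A := by
  unfold FullLagrangian
  have h := hasDerivAt_id' A
  have h3 := h.fun_pow 3
  refine (((((h.mul_const (P ^ 2)).fun_neg.div_const (2 * n)).fun_add
    (h.const_mul ((1/2) * k * n))).fun_add ((h3.mul_const (Q ^ 2)).div_const (2 * n))).fun_sub
    ((h3.const_mul n).mul_const (V F))).congr_deriv ?_
  field_simp
  norm_num
  ring

theorem FullLagrangian_hasDerivAt_scaleVelocity (V : ℝ → ℝ) (k A P F Q n : ℝ) :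
    HasDerivAt (fun p => FullLagrangian V k A p F Q n) (-(A * P) / n) P := by
  unfold FullLagrangian
  refine ((((((((hasDerivAt_id' P).fun_pow 2).const_mul A).fun_neg.div_const (2 * n)).add_const
    ((1/2) * k * n * A))).add_const ((A ^ 3 * Q ^ 2) / (2 * n))).sub_const
    (n * A ^ 3 * V F)).congr_deriv ?_
  simp only [div_eq_mul_inv, mul_inv]
  norm_num
  ring

theorem FullLagrangian_hasDerivAt_field (V : ℝ → ℝ) (k A P F Q n V' : ℝ)
    (hV : HasDerivAt V V' F) :
    HasDerivAt (fun x => FullLagrangian V k A P x Q n) (-(n * A ^ 3 * V')) F := by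
  unfold FullLagrangian
  exact (hV.const_mul (n * A ^ 3)).const_sub _

theorem FullLagrangian_hasDerivAt_fieldVelocity (V : ℝ → ℝ) (k A P F Q n : ℝ) :
    HasDerivAt (fun q => FullLagrangian V k A P F q n) (A ^ 3 * Q / n) Q := by
  unfold FullLagrangian
  refine ((((((hasDerivAt_id' Q).fun_pow 2).const_mul (A ^ 3)).div_const (2 * n)).const_add
    (-(A * P ^ 2) / (2 * n) + (1/2) * k * n * A)).sub_const (n * A ^ 3 * V F)).congr_deriv ?_
  simp only [div_eq_mul_inv, mul_inv]
  norm_num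
  ring

theorem FullLagrangian_hasDerivAt_lapse (V : ℝ → ℝ) (k A P F Q n : ℝ) (hn : n ≠ 0) :
    HasDerivAt (fun m => FullLagrangian V k A P F Q m)
      (A * P ^ 2 / (2 * n ^ 2) + (1/2) * k * A - A ^ 3 * Q ^ 2 / (2 * n ^ 2) - A ^ 3 * V F)
      n := by
  unfold FullLagrangian
  have h := hasDerivAt_id' n
  have h2 := h.const_mul 2
  have hn2 : 2 * n ≠ 0 := by positivity
  refine (((((hasDerivAt_const n (-(A * P ^ 2))).fun_div h2 hn2).fun_add
    ((h.const_mul ((1/2) * k)).mul_const A)).fun_add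
    ((hasDerivAt_const n (A ^ 3 * Q ^ 2)).fun_div h2 hn2)).fun_sub
    ((h.mul_const (A ^ 3)).mul_const (V F))).congr_deriv ?_
  field_simp
  ring

/-- Noether identity in characteristic form for the time-translation symmetry of the full
lapse Lagrangian `L = -a(a')²/(2N) + (1/2)kNa + a³(φ')²/(2N) - Na³V(φ)`: with no
equations of motion assumed,
`a'·(∂L/∂a − d/dt ∂L/∂a') + φ'·(∂L/∂φ − d/dt ∂L/∂φ') + N'·∂L/∂N
  = d/dt[(a/(2N))((a')² + N²k − 2N²a²V(φ) − a²(φ')²)]`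
(`L` does not depend on `N'`, so the Euler–Lagrange expression in `N` is `∂L/∂N`). -/
theorem full_FRW_Noether_identity
    (V : ℝ → ℝ) (hV : ContDiff ℝ 1 V) (k : ℝ)
    (I : Set ℝ) (hI : I.OrdConnected)
    (a φ N a' φ' N' a'' φ'' N'' : ℝ → ℝ)
    (ha' : ∀ t ∈ I, HasDerivAt a (a' t) t)
    (ha'' : ∀ t ∈ I, HasDerivAt a' (a'' t) t)
    (hφ' : ∀ t ∈ I, HasDerivAt φ (φ' t) t)
    (hφ'' : ∀ t ∈ I, HasDerivAt φ' (φ'' t) t)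
    (hN' : ∀ t ∈ I, HasDerivAt N (N' t) t)
    (hN'' : ∀ t ∈ I, HasDerivAt N' (N'' t) t)
    (hNpos : ∀ t ∈ I, 0 < N t) :
    ∀ t ∈ I,
      a' t * (deriv (fun x => FullLagrangian V k x (a' t) (φ t) (φ' t) (N t)) (a t)
          - deriv (fun s =>
              deriv (fun p => FullLagrangian V k (a s) p (φ s) (φ' s) (N s)) (a' s)) t)
        + φ' t * (deriv (fun x => FullLagrangian V k (a t) (a' t) x (φ' t) (N t)) (φ t)
          - deriv (fun s =>
              deriv (fun q => FullLagrangian V k (a s) (a' s) (φ s) q (N s)) (φ' s)) t)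
        + N' t * deriv (fun n => FullLagrangian V k (a t) (a' t) (φ t) (φ' t) n) (N t)
      = deriv (fun s => (a s / (2 * N s))
          * ((a' s) ^ 2 + (N s) ^ 2 * k - 2 * (N s) ^ 2 * (a s) ^ 2 * V (φ s)
            - (a s) ^ 2 * (φ' s) ^ 2)) t := by
  intro t ht
  have hn : N t ≠ 0 := (hNpos t ht).ne'
  have hn2 : 2 * N t ≠ 0 := mul_ne_zero two_ne_zero hn
  have da := ha' t ht
  have dP := ha'' t ht
  have dφ := hφ' t ht
  have dQ := hφ'' t ht
  have dN := hN' t ht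
  have dV : HasDerivAt V (deriv V (φ t)) (φ t) :=
    (hV.differentiable one_ne_zero (φ t)).hasDerivAt
  have dVφ : HasDerivAt (fun s => V (φ s)) (deriv V (φ t) * φ' t) t := dV.comp t dφ
  simp only [(FullLagrangian_hasDerivAt_scaleVelocity _ _ _ _ _ _ _).deriv,
    (FullLagrangian_hasDerivAt_fieldVelocity _ _ _ _ _ _ _).deriv]
  rw [(FullLagrangian_hasDerivAt_scale V k _ _ _ _ _ hn).deriv,
    (FullLagrangian_hasDerivAt_field V k _ _ _ _ _ _ dV).deriv,
    (FullLagrangian_hasDerivAt_lapse V k _ _ _ _ _ hn).deriv,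
    ((da.fun_mul dP).fun_neg.fun_div dN hn).deriv,
    (((da.fun_pow 3).fun_mul dQ).fun_div dN hn).deriv,
    ((da.fun_div (dN.const_mul 2) hn2).fun_mul
      ((((dP.fun_pow 2).fun_add ((dN.fun_pow 2).mul_const k)).fun_sub
        ((((dN.fun_pow 2).const_mul 2).fun_mul (da.fun_pow 2)).fun_mul dVφ)).fun_sub
        ((da.fun_pow 2).fun_mul (dQ.fun_pow 2)))).deriv]
  field_simp
  norm_num
  ring
end
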